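/- Let k be an algebraically closed field of characteristic 0, q ∈ k^× and ω ∈ k a primitive third root of unity. In the free algebra k⟨x_1,x_2,x_3⟩ define z_0 := x_3, z_1 := x_2x_3 − q·x_3x_2, z_2 := x_2·z_1 − q·z_1·x_2 and z_{1,0} := z_1·z_0 − q·ω·z_0·z_1. Let A be the quotient of k⟨x_1,x_2,x_3⟩ by the two-sided ideal generated by: x_2x_1 − x_1x_2 + (1/2)x_1², x_1x_3 − q·x_3x_1, z_2, x_3³, z_1³, and z_{1,0}³. Then the images of the monomials x_1^{m_1}·x_2^{m_2}·z_1^{n_1}·z_{1,0}^{n_2}·z_0^{n_3}, with m_1, m_2 ∈ ℕ and 0 ≤ n_1, n_2, n_3 ≤ 2, form a k-basis of A, and GKdim A = 2. (A is the Nichols algebra B(lstr(ω,1)) of a Jordan block, a point with label ω, weak interaction and ghost 1.) -/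

import Mathlib

open scoped ENNReal

/-- The Gelfand–Kirillov dimension of a `k`-algebra `A`. -/
noncomputable def GKdim (k A : Type*) [Field k] [Ring A] [Algebra k A] : ℝ≥0∞ :=
  ⨆ (V : Submodule k A) (_ : FiniteDimensional k V),
    Filter.limsup
      (fun n : ℕ =>
        ENNReal.ofReal
          (Real.log ((Module.finrank k (↥(∑ j ∈ Finset.range (n + 1), V ^ j)) : ℕ) : ℝ) /
            Real.log (n : ℝ)))
      Filter.atTop

/-- The generator `x_{i+1}` of the free algebra `k⟨x₁,x₂,x₃⟩`. -/
noncomputable def X (k : Type*) [Field k] (i : Fin 3) : FreeAlgebra k (Fin 3) :=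
  FreeAlgebra.ι k i

/-- `z₁ := x₂x₃ − q x₃x₂`. -/
noncomputable def z1 (k : Type*) [Field k] (q : k) : FreeAlgebra k (Fin 3) :=
  X k 1 * X k 2 - q • (X k 2 * X k 1)

/-- `z₂ := x₂ z₁ − q z₁ x₂`. -/
noncomputable def z2 (k : Type*) [Field k] (q : k) : FreeAlgebra k (Fin 3) :=
  X k 1 * z1 k q - q • (z1 k q * X k 1)

/-- `z₁₀ := z₁ z₀ − qω z₀ z₁`, with `z₀ = x₃`. -/
noncomputable def z10 (k : Type*) [Field k] (q ω : k) : FreeAlgebra k (Fin 3) :=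
  z1 k q * X k 2 - (q * ω) • (X k 2 * z1 k q)

/-- The defining relations of `B(lstr(ω,1))`. -/
def lstrRel (k : Type*) [Field k] (q ω : k)
    (a b : FreeAlgebra k (Fin 3)) : Prop :=
  b = 0 ∧
    (a = X k 1 * X k 0 - X k 0 * X k 1 + ((2 : k)⁻¹) • (X k 0 * X k 0) ∨
     a = X k 0 * X k 2 - q • (X k 2 * X k 0) ∨
     a = z2 k q ∨
     a = X k 2 ^ 3 ∨
     a = z1 k q ^ 3 ∨
     a = z10 k q ω ^ 3)

/-- The PBW monomials `x₁^{m₁} x₂^{m₂} z₁^{n₁} z₁₀^{n₂} z₀^{n₃}` with `0 ≤ nᵢ ≤ 2`. -/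
noncomputable def bas (k : Type*) [Field k] (q ω : k)
    (p : ℕ × ℕ × Fin 3 × Fin 3 × Fin 3) : RingQuot (lstrRel k q ω) :=
  RingQuot.mkAlgHom k (lstrRel k q ω)
    (X k 0 ^ p.1 * X k 1 ^ p.2.1 * z1 k q ^ ((p.2.2.1 : ℕ)) *
      z10 k q ω ^ ((p.2.2.2.1 : ℕ)) * X k 2 ^ ((p.2.2.2.2 : ℕ)))


/-- Generators `x, y, z` of a `k`-algebra, together with the auxiliary elements `u, v`, satisfying
the defining relations of `B(lstr(ω,1))`. -/
structure LstrTuple {k A : Type*} [Field k] [Ring A] [Algebra k A] (q ω : k)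
    (x y z u v : A) : Prop where
  y_mul_x : y * x = x * y - (2 : k)⁻¹ • (x * x)
  x_mul_z : x * z = q • (z * x)
  y_mul_z : y * z = q • (z * y) + u
  y_mul_u : y * u = q • (u * y)
  v_eq : v = u * z - (q * ω) • (z * u)
  z_cube : z ^ 3 = 0
  u_cube : u ^ 3 = 0
  v_cube : v ^ 3 = 0

theorem mul_pow_of_mul_eq_smul {k A : Type*} [Field k] [Ring A] [Algebra k A] {a b : A} {c : k}
    (h : a * b = c • (b * a)) (n : ℕ) : a * b ^ n = c ^ n • (b ^ n * a) := by
  induction n with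
  | zero => simp
  | succ n ih =>
    rw [pow_succ, ← mul_assoc, ih, smul_mul_assoc, mul_assoc, h, mul_smul_comm, smul_smul,
      ← mul_assoc, ← pow_succ, ← pow_succ]

namespace LstrTuple

variable {k A : Type*} [Field k] [Ring A] [Algebra k A] {q ω : k} {x y z u v : A}

theorem z_mul_x (h : LstrTuple q ω x y z u v) (hq : q ≠ 0) : z * x = q⁻¹ • (x * z) := by
  rw [h.x_mul_z, smul_smul, inv_mul_cancel₀ hq, one_smul]

theorem u_mul_y (h : LstrTuple q ω x y z u v) (hq : q ≠ 0) : u * y = q⁻¹ • (y * u) := by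
  rw [h.y_mul_u, smul_smul, inv_mul_cancel₀ hq, one_smul]

theorem z_mul_y (h : LstrTuple q ω x y z u v) (hq : q ≠ 0) :
    z * y = q⁻¹ • (y * z) - q⁻¹ • u := by
  rw [h.y_mul_z, smul_add, smul_smul, inv_mul_cancel₀ hq, one_smul, add_sub_cancel_right]

theorem x_mul_u (h : LstrTuple q ω x y z u v) : x * u = q • (u * x) := by
  have hu : u = y * z - q • (z * y) := by rw [h.y_mul_z]; abel
  have h1 := h.y_mul_x
  have h2 := h.x_mul_z
  rw [hu]
  linear_combination (norm := skip) (-1 : k) • (h1 * z) + q ^ 2 • (z * h1) + y * h2 - q • (h2 * y)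
    + (2 : k)⁻¹ • (x * h2) + ((2 : k)⁻¹ * q) • (h2 * x)
  simp only [mul_sub, sub_mul, smul_mul_assoc, mul_smul_comm, mul_assoc]
  module

theorem u_mul_x (h : LstrTuple q ω x y z u v) (hq : q ≠ 0) : u * x = q⁻¹ • (x * u) := by
  rw [h.x_mul_u, smul_smul, inv_mul_cancel₀ hq, one_smul]

theorem serre_one (h : LstrTuple q ω x y z u v) :
    u * z * z + q • (z * u * z) + (q ^ 2) • (z * z * u) = 0 := by
  have h1 := h.y_mul_z
  have h2 := h.z_cube
  rw [pow_three] at h2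
  linear_combination (norm := skip) (-1 : k) • (h1 * (z * z)) - q • (z * h1 * z)
    - q ^ 2 • (z * z * h1) + y * h2 - q ^ 3 • (h2 * y)
  simp only [mul_add, add_mul, smul_mul_assoc, mul_smul_comm, mul_assoc, mul_zero, zero_mul]
  module

theorem serre_two [CharZero k] (h : LstrTuple q ω x y z u v) (hq : q ≠ 0) :
    u * u * z + q • (u * z * u) + (q ^ 2) • (z * u * u) = 0 := by
  have h1 := h.y_mul_z
  have h2 := h.y_mul_u
  have h3 := h.serre_one
  have : (2 * q) • (u * u * z + q • (u * z * u) + (q ^ 2) • (z * u * u)) = 0 := by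
    linear_combination (norm := skip) y * h3 - q ^ 3 • (h3 * y)
      - h2 * (z * z) - q • (u * h1 * z) - q ^ 2 • (u * z * h1)
      - q • (h1 * (u * z)) - q ^ 2 • (z * h2 * z) - q ^ 3 • (z * u * h1)
      - q ^ 2 • (h1 * (z * u)) - q ^ 3 • (z * h1 * u) - q ^ 4 • (z * z * h2)
    simp only [mul_add, add_mul, smul_mul_assoc, mul_smul_comm, mul_assoc, mul_zero, zero_mul]
    module
  exact (smul_eq_zero.mp this).resolve_left (mul_ne_zero two_ne_zero hq)

theorem z_mul_u (h : LstrTuple q ω x y z u v) (hq : q ≠ 0) (hω : ω ^ 2 + ω + 1 = 0) :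
    z * u = (q⁻¹ * ω ^ 2) • (u * z) - (q⁻¹ * ω ^ 2) • v := by
  have h3 : q⁻¹ * ω ^ 2 * (q * ω) = 1 := by
    field_simp
    linear_combination (ω - 1) * hω
  rw [h.v_eq, smul_sub, smul_smul, h3]
  module

theorem z_mul_v (h : LstrTuple q ω x y z u v) (hq : q ≠ 0) (hω : ω ^ 2 + ω + 1 = 0) :
    z * v = (q⁻¹ * ω) • (v * z) := by
  have h1 := h.serre_one
  have h2 := h.z_mul_u hq hω
  have h3 := h.v_eq
  have h4 : ω ^ 3 = 1 := by linear_combination (ω - 1) * hω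
  have h5 : ω ^ 2 = - ω - 1 := by linear_combination hω
  have h6 : q⁻¹ * ω * (q * ω) = - ω - 1 := by
    field_simp
    exact h5
  have h7 : q⁻¹ * ω * q = ω := by field_simp
  have h8 : q⁻¹ * ω * q ^ 2 = q * ω := by field_simp
  have : z * v - (q⁻¹ * ω) • (v * z)
      = -(q⁻¹ * ω) • (u * z * z + q • (z * u * z) + (q ^ 2) • (z * z * u)) := by
    rw [h3]
    simp only [mul_sub, sub_mul, smul_mul_assoc, mul_smul_comm, mul_assoc,
      smul_add, smul_sub, smul_smul, neg_mul, h6, h7, h8]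
    module
  rwa [h1, smul_zero, sub_eq_zero] at this

theorem v_mul_u [CharZero k] (h : LstrTuple q ω x y z u v) (hq : q ≠ 0)
    (hω : ω ^ 2 + ω + 1 = 0) : v * u = (q⁻¹ * ω) • (u * v) := by
  have h1 := h.serre_two hq
  have h3 := h.v_eq
  have h5 : ω ^ 2 = - ω - 1 := by linear_combination hω
  have h6 : q⁻¹ * ω * (q * ω) = - ω - 1 := by
    field_simp
    exact h5
  have h7 : q⁻¹ * ω * q = ω := by field_simp
  have h8 : q⁻¹ * ω * q ^ 2 = q * ω := by field_simp
  have : v * u - (q⁻¹ * ω) • (u * v)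
      = -(q⁻¹ * ω) • (u * u * z + q • (u * z * u) + (q ^ 2) • (z * u * u)) := by
    rw [h3]
    simp only [mul_sub, sub_mul, smul_mul_assoc, mul_smul_comm, mul_assoc,
      smul_add, smul_sub, smul_smul, neg_mul, h6, h7, h8]
    module
  rwa [h1, smul_zero, sub_eq_zero] at this

theorem y_mul_x_pow (h : LstrTuple q ω x y z u v) (n : ℕ) :
    y * x ^ n = x ^ n * y - ((n : k) * 2⁻¹) • x ^ (n + 1) := by
  induction n with
  | zero => simp
  | succ n ih =>
    rw [pow_succ, ← mul_assoc, ih, sub_mul, mul_assoc, h.y_mul_x, mul_sub, mul_smul_comm,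
      smul_mul_assoc, ← pow_succ, ← mul_assoc, ← mul_assoc, ← pow_succ, ← pow_succ]
    push_cast
    module

theorem z_mul_y_pow (h : LstrTuple q ω x y z u v) (hq : q ≠ 0) (n : ℕ) :
    z * y ^ n = q⁻¹ ^ n • (y ^ n * z) - ((n : k) * q⁻¹ ^ n) • (y ^ (n - 1) * u) := by
  induction n with
  | zero => simp
  | succ n ih =>
    rw [pow_succ, ← mul_assoc, ih, sub_mul, smul_mul_assoc, smul_mul_assoc, mul_assoc, mul_assoc,
      h.z_mul_y hq, h.u_mul_y hq, mul_sub, mul_smul_comm, mul_smul_comm, mul_smul_comm,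
      ← mul_assoc, ← mul_assoc, ← pow_succ]
    rcases n with _ | n
    · simp
    · simp only [Nat.add_sub_cancel, ← pow_succ]
      push_cast
      module

theorem exists_z_mul_u_pow [CharZero k] (h : LstrTuple q ω x y z u v) (hq : q ≠ 0)
    (hω : ω ^ 2 + ω + 1 = 0) (n : ℕ) :
    ∃ c d : k, z * u ^ n = c • (u ^ n * z) - d • (u ^ (n - 1) * v) := by
  suffices H : ∀ n : ℕ, ∃ c d : k, z * u ^ (n + 1) = c • (u ^ (n + 1) * z) - d • (u ^ n * v) by
    rcases n with _ | n
    · exact ⟨1, 0, by simp⟩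
    · exact H n
  intro n
  induction n with
  | zero => exact ⟨_, _, by simpa using h.z_mul_u hq hω⟩
  | succ n ih =>
    obtain ⟨c, d, hn⟩ := ih
    refine ⟨c * (q⁻¹ * ω ^ 2), c * (q⁻¹ * ω ^ 2) + d * (q⁻¹ * ω), ?_⟩
    rw [pow_succ, ← mul_assoc, hn, sub_mul, smul_mul_assoc, smul_mul_assoc, mul_assoc, mul_assoc,
      h.z_mul_u hq hω, h.v_mul_u hq hω, mul_sub, mul_smul_comm, mul_smul_comm, mul_smul_comm,
      ← mul_assoc, ← mul_assoc, ← pow_succ, ← mul_assoc, ← pow_succ]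
    module

/-- The span of the monomials `x ^ i * y ^ j * u ^ a * v ^ b * z ^ c` with `i + j ≤ N`. -/
def monomialSpan (k : Type*) {A : Type*} [Field k] [Ring A] [Algebra k A] (x y z u v : A)
    (N : ℕ) : Submodule k A :=
  Submodule.span k {w | ∃ i j a b c : ℕ, i + j ≤ N ∧ x ^ i * y ^ j * u ^ a * v ^ b * z ^ c = w}

theorem mem_monomialSpan {N i j : ℕ} (a b c : ℕ) (hN : i + j ≤ N) :
    x ^ i * (y ^ j * (u ^ a * (v ^ b * z ^ c))) ∈ monomialSpan k x y z u v N :=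
  Submodule.subset_span ⟨i, j, a, b, c, hN, by simp only [mul_assoc]⟩

theorem monomialSpan_mono {M N : ℕ} (hMN : M ≤ N) :
    monomialSpan k x y z u v M ≤ monomialSpan k x y z u v N := by
  refine Submodule.span_mono ?_
  rintro w ⟨i, j, a, b, c, h, rfl⟩
  exact ⟨i, j, a, b, c, h.trans hMN, rfl⟩

theorem mul_mem_monomialSpan_of_forall {N M : ℕ} {g w : A}
    (hg : ∀ i j a b c : ℕ, i + j ≤ N →
      g * (x ^ i * (y ^ j * (u ^ a * (v ^ b * z ^ c)))) ∈ monomialSpan k x y z u v M)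
    (hw : w ∈ monomialSpan k x y z u v N) : g * w ∈ monomialSpan k x y z u v M := by
  induction hw using Submodule.span_induction with
  | mem w hw =>
    obtain ⟨i, j, a, b, c, h, rfl⟩ := hw
    simpa only [mul_assoc] using hg i j a b c h
  | zero => simp
  | add w₁ w₂ _ _ h₁ h₂ => rw [mul_add]; exact add_mem h₁ h₂
  | smul r w _ h => rw [mul_smul_comm]; exact Submodule.smul_mem _ r h

theorem x_mul_mem {N : ℕ} {w : A} (hw : w ∈ monomialSpan k x y z u v N) :
    x * w ∈ monomialSpan k x y z u v (N + 1) := by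
  refine mul_mem_monomialSpan_of_forall (fun i j a b c hN => ?_) hw
  rw [← mul_assoc, ← pow_succ']
  exact mem_monomialSpan a b c (by omega)

theorem y_mul_mem (h : LstrTuple q ω x y z u v) {N : ℕ} {w : A}
    (hw : w ∈ monomialSpan k x y z u v N) : y * w ∈ monomialSpan k x y z u v (N + 1) := by
  refine mul_mem_monomialSpan_of_forall (fun i j a b c hN => ?_) hw
  rw [← mul_assoc, h.y_mul_x_pow, sub_mul, mul_assoc, ← mul_assoc y, ← pow_succ', smul_mul_assoc]
  exact sub_mem (mem_monomialSpan a b c (by omega))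
    (Submodule.smul_mem _ _ (mem_monomialSpan a b c (by omega)))

theorem u_mul_mem (h : LstrTuple q ω x y z u v) (hq : q ≠ 0) {N : ℕ} {w : A}
    (hw : w ∈ monomialSpan k x y z u v N) : u * w ∈ monomialSpan k x y z u v N := by
  refine mul_mem_monomialSpan_of_forall (fun i j a b c hN => ?_) hw
  rw [← mul_assoc, mul_pow_of_mul_eq_smul (h.u_mul_x hq), smul_mul_assoc, mul_assoc,
    ← mul_assoc u, mul_pow_of_mul_eq_smul (h.u_mul_y hq), smul_mul_assoc, mul_assoc,
    ← mul_assoc u, ← pow_succ', mul_smul_comm]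
  exact Submodule.smul_mem _ _ (Submodule.smul_mem _ _ (mem_monomialSpan _ b c hN))

theorem z_mul_mem [CharZero k] (h : LstrTuple q ω x y z u v) (hq : q ≠ 0)
    (hω : ω ^ 2 + ω + 1 = 0) {N : ℕ} {w : A}
    (hw : w ∈ monomialSpan k x y z u v N) : z * w ∈ monomialSpan k x y z u v N := by
  refine mul_mem_monomialSpan_of_forall (fun i j a b c hN => ?_) hw
  obtain ⟨r, s, hrs⟩ := h.exists_z_mul_u_pow hq hω a
  have hz : z * (u ^ a * (v ^ b * z ^ c)) = (r * (q⁻¹ * ω) ^ b) • (u ^ a * (v ^ b * z ^ (c + 1)))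
      - s • (u ^ (a - 1) * (v ^ (b + 1) * z ^ c)) := by
    rw [← mul_assoc, hrs, sub_mul, smul_mul_assoc, smul_mul_assoc, mul_assoc, mul_assoc,
      ← mul_assoc z, mul_pow_of_mul_eq_smul (h.z_mul_v hq hω), ← mul_assoc v, ← pow_succ',
      smul_mul_assoc, mul_smul_comm, smul_smul, mul_assoc, ← pow_succ']
  rw [← mul_assoc, mul_pow_of_mul_eq_smul (h.z_mul_x hq), smul_mul_assoc, mul_assoc,
    ← mul_assoc z, h.z_mul_y_pow hq, sub_mul, smul_mul_assoc, smul_mul_assoc, mul_assoc, hz,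
    mul_assoc, ← mul_assoc u, ← pow_succ']
  simp only [mul_sub, mul_smul_comm]
  exact Submodule.smul_mem _ _ (sub_mem (Submodule.smul_mem _ _ (sub_mem
    (Submodule.smul_mem _ _ (mem_monomialSpan _ _ _ hN))
    (Submodule.smul_mem _ _ (mem_monomialSpan _ _ _ hN))))
    (Submodule.smul_mem _ _ (mem_monomialSpan _ _ _ (by omega))))

theorem v_mul_mem [CharZero k] (h : LstrTuple q ω x y z u v) (hq : q ≠ 0)
    (hω : ω ^ 2 + ω + 1 = 0) {N : ℕ} {w : A}
    (hw : w ∈ monomialSpan k x y z u v N) : v * w ∈ monomialSpan k x y z u v N := by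
  have hv : v * w = u * (z * w) - (q * ω) • (z * (u * w)) := by
    rw [h.v_eq, sub_mul, smul_mul_assoc, mul_assoc, mul_assoc]
  rw [hv]
  exact sub_mem (h.u_mul_mem hq (h.z_mul_mem hq hω hw))
    (Submodule.smul_mem _ _ (h.z_mul_mem hq hω (h.u_mul_mem hq hw)))

theorem pow_mul_mem {N d : ℕ} {g w : A}
    (hg : ∀ (M : ℕ) (w : A), w ∈ monomialSpan k x y z u v M →
      g * w ∈ monomialSpan k x y z u v (M + d))
    (hw : w ∈ monomialSpan k x y z u v N) (n : ℕ) :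
    g ^ n * w ∈ monomialSpan k x y z u v (N + n * d) := by
  induction n with
  | zero => simpa using hw
  | succ n ih =>
    rw [pow_succ', mul_assoc, Nat.add_mul, one_mul, ← add_assoc]
    exact hg _ _ ih

theorem mul_mem_monomialSpan [CharZero k] (h : LstrTuple q ω x y z u v) (hq : q ≠ 0)
    (hω : ω ^ 2 + ω + 1 = 0) {M N : ℕ} {w₁ w₂ : A} (h₁ : w₁ ∈ monomialSpan k x y z u v M)
    (h₂ : w₂ ∈ monomialSpan k x y z u v N) : w₁ * w₂ ∈ monomialSpan k x y z u v (M + N) := by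
  induction h₁ using Submodule.span_induction with
  | mem w hw =>
    obtain ⟨i, j, a, b, c, hij, rfl⟩ := hw
    simp only [mul_assoc]
    have hz := pow_mul_mem (d := 0) (fun _ _ => h.z_mul_mem hq hω) h₂ c
    have hv := pow_mul_mem (d := 0) (fun _ _ => h.v_mul_mem hq hω) hz b
    have hu := pow_mul_mem (d := 0) (fun _ _ => h.u_mul_mem hq) hv a
    have hy := pow_mul_mem (d := 1) (fun _ _ => h.y_mul_mem) hu j
    exact monomialSpan_mono (by omega) (pow_mul_mem (d := 1) (fun _ _ => x_mul_mem) hy i)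
  | zero => simp
  | add w₁ w₂ _ _ h₁ h₂ => rw [add_mul]; exact add_mem h₁ h₂
  | smul r w _ h => rw [smul_mul_assoc]; exact Submodule.smul_mem _ r h

theorem one_mem_monomialSpan (N : ℕ) : (1 : A) ∈ monomialSpan k x y z u v N := by
  simpa using mem_monomialSpan (k := k) (x := x) (y := y) (z := z) (u := u) (v := v)
    (i := 0) (j := 0) 0 0 0 (Nat.zero_le N)

theorem pow_le_monomialSpan [CharZero k] (h : LstrTuple q ω x y z u v) (hq : q ≠ 0)
    (hω : ω ^ 2 + ω + 1 = 0) {d : ℕ} {V : Submodule k A} (hV : V ≤ monomialSpan k x y z u v d)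
    (n : ℕ) : V ^ n ≤ monomialSpan k x y z u v (n * d) := by
  induction n with
  | zero =>
    rw [pow_zero, Submodule.one_le]
    exact one_mem_monomialSpan _
  | succ n ih =>
    rw [pow_succ, Submodule.mul_le, Nat.add_mul, one_mul]
    exact fun a ha b hb => h.mul_mem_monomialSpan hq hω (ih ha) (hV hb)

theorem monomialSpan_eq_span_truncated (h : LstrTuple q ω x y z u v) (N : ℕ) :
    monomialSpan k x y z u v N = Submodule.span k
      ((fun p : ℕ × ℕ × Fin 3 × Fin 3 × Fin 3 => x ^ p.1 * y ^ p.2.1 * u ^ (p.2.2.1 : ℕ) *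
        v ^ (p.2.2.2.1 : ℕ) * z ^ (p.2.2.2.2 : ℕ)) '' {p | p.1 + p.2.1 ≤ N}) := by
  apply le_antisymm
  · refine Submodule.span_le.mpr ?_
    rintro w ⟨i, j, a, b, c, hN, rfl⟩
    by_cases ha : a < 3
    · by_cases hb : b < 3
      · by_cases hc : c < 3
        · exact Submodule.subset_span ⟨(i, j, ⟨a, ha⟩, ⟨b, hb⟩, ⟨c, hc⟩), hN, rfl⟩
        · simp [pow_eq_zero_of_le (not_lt.mp hc) h.z_cube]
      · simp [pow_eq_zero_of_le (not_lt.mp hb) h.v_cube]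
    · simp [pow_eq_zero_of_le (not_lt.mp ha) h.u_cube]
  · refine Submodule.span_mono ?_
    rintro w ⟨p, hp, rfl⟩
    exact ⟨p.1, p.2.1, _, _, _, hp, rfl⟩

end LstrTuple

namespace LstrAction

variable {k : Type*} [Field k]

/-- The shift `(g 0, g 1, g 2) ↦ (g 1, g 2, 0)`. -/
def shift (k V : Type*) [Field k] [AddCommGroup V] [Module k V] : Module.End k (Fin 3 → V) where
  toFun g := ![g 1, g 2, 0]
  map_add' g h := by ext i; fin_cases i <;> simp
  map_smul' c g := by ext i; fin_cases i <;> simp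

theorem shift_apply {V : Type*} [AddCommGroup V] [Module k V] (g : Fin 3 → V) :
    shift k V g = ![g 1, g 2, 0] := rfl

theorem shift_shift_shift {V : Type*} [AddCommGroup V] [Module k V] (g : Fin 3 → V) :
    shift k V (shift k V (shift k V g)) = 0 := by
  ext i; fin_cases i <;> simp [shift_apply]

/-- The weighted shift of the last coordinate, with weight `s ^ b`. -/
def innerShift (s : k) : Module.End k (Fin 3 → Fin 3 → k) where
  toFun g b := s ^ (b : ℕ) • shift k k (g b)
  map_add' g h := by ext; simp [mul_add]
  map_smul' c g := by ext; simp; ring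

theorem innerShift_apply (s : k) (g : Fin 3 → Fin 3 → k) (b : Fin 3) :
    innerShift s g b = s ^ (b : ℕ) • shift k k (g b) := rfl

theorem innerShift_cube (s : k) (g : Fin 3 → Fin 3 → k) :
    innerShift s (innerShift s (innerShift s g)) = 0 := by
  ext b : 1
  simp [innerShift_apply, shift_shift_shift]

theorem shift_innerShift (s : k) (g : Fin 3 → Fin 3 → k) :
    shift k _ (innerShift s g) = s • innerShift s (shift k _ g) := by
  ext b c
  fin_cases b <;> fin_cases c <;> simp [shift_apply, innerShift_apply] <;> ring

section Fiber

variable {U : Type*} [AddCommGroup U] [Module k U]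

/-- The operator dual to left multiplication by `z₀` on the subalgebra generated by `z₀, z₁`. -/
def Z0 (q ω : k) (B C : Module.End k U) : Module.End k (Fin 3 → U) where
  toFun g := ![C (g 0), (q⁻¹ * ω ^ 2) • C (g 1) - (q⁻¹ * ω ^ 2) • B (g 0),
    (q⁻¹ * ω ^ 2) ^ 2 • C (g 2) + (q⁻¹ ^ 2 * ω ^ 2) • B (g 1)]
  map_add' g h := by
    ext i
    fin_cases i <;> simp <;> module
  map_smul' c g := by
    ext i
    fin_cases i <;> simp <;> module

variable {q ω : k} {B C : Module.End k U}

theorem Z0_apply (g : Fin 3 → U) : Z0 q ω B C g =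
    ![C (g 0), (q⁻¹ * ω ^ 2) • C (g 1) - (q⁻¹ * ω ^ 2) • B (g 0),
      (q⁻¹ * ω ^ 2) ^ 2 • C (g 2) + (q⁻¹ ^ 2 * ω ^ 2) • B (g 1)] := rfl

theorem Z0_cube (hω : ω ^ 2 + ω + 1 = 0)
    (hBC : ∀ g, B (C g) = (q⁻¹ * ω) • C (B g)) (hC : ∀ g, C (C (C g)) = 0) (g : Fin 3 → U) :
    Z0 q ω B C (Z0 q ω B C (Z0 q ω B C g)) = 0 := by
  ext i
  fin_cases i <;> simp [Z0_apply, hBC, hC] <;> match_scalars <;> grind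

theorem serre_one (hq : q ≠ 0) (hω : ω ^ 2 + ω + 1 = 0)
    (hBC : ∀ g, B (C g) = (q⁻¹ * ω) • C (B g)) (g : Fin 3 → U) :
    Z0 q ω B C (Z0 q ω B C (shift k U g)) + q • Z0 q ω B C (shift k U (Z0 q ω B C g)) +
      q ^ 2 • shift k U (Z0 q ω B C (Z0 q ω B C g)) = 0 := by
  ext i
  fin_cases i <;> simp [Z0_apply, shift_apply, hBC] <;> match_scalars <;> grind

theorem serre_two (hq : q ≠ 0) (hω : ω ^ 2 + ω + 1 = 0) (g : Fin 3 → U) :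
    Z0 q ω B C (shift k U (shift k U g)) + q • shift k U (Z0 q ω B C (shift k U g)) +
      q ^ 2 • shift k U (shift k U (Z0 q ω B C g)) = 0 := by
  ext i
  fin_cases i <;> simp [Z0_apply, shift_apply] <;> match_scalars <;> grind

/-- The operator dual to left multiplication by `z₁₀`. -/
def Z10 (q ω : k) (B C : Module.End k U) : Module.End k (Fin 3 → U) :=
  Z0 q ω B C * shift k U - (q * ω) • (shift k U * Z0 q ω B C)

theorem Z10_apply (g : Fin 3 → U) : Z10 q ω B C g =
    Z0 q ω B C (shift k U g) - (q * ω) • shift k U (Z0 q ω B C g) := rfl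

theorem Z10_apply' (hq : q ≠ 0) (hω : ω ^ 2 + ω + 1 = 0) (g : Fin 3 → U) : Z10 q ω B C g =
    ![B (g 0), (q⁻¹ * ω) • B (g 1), (q⁻¹ * ω) ^ 2 • B (g 2)] := by
  ext i
  fin_cases i <;> simp [Z10_apply, Z0_apply, shift_apply] <;> match_scalars <;> grind

theorem Z10_cube (hq : q ≠ 0) (hω : ω ^ 2 + ω + 1 = 0) (hB : ∀ g, B (B (B g)) = 0)
    (g : Fin 3 → U) : Z10 q ω B C (Z10 q ω B C (Z10 q ω B C g)) = 0 := by
  ext i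
  fin_cases i <;> simp [Z10_apply' hq hω, hB]

theorem Z10_shift (hq : q ≠ 0) (hω : ω ^ 2 + ω + 1 = 0) (g : Fin 3 → U) :
    Z10 q ω B C (shift k U g) = (q * ω ^ 2) • shift k U (Z10 q ω B C g) := by
  ext i
  fin_cases i <;> simp [Z10_apply' hq hω, shift_apply] <;> match_scalars <;> grind

end Fiber

section Total

variable {V : Type*} [AddCommGroup V] [Module k V]

/-- The operator dual to left multiplication by `x₁`. -/
def T1 (k V : Type*) [Field k] [AddCommGroup V] [Module k V] : Module.End k (ℕ → ℕ → V) where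
  toFun f m n := f (m + 1) n
  map_add' _ _ := rfl
  map_smul' _ _ := rfl

/-- The operator dual to left multiplication by `x₂`. -/
def T2 (k V : Type*) [Field k] [AddCommGroup V] [Module k V] : Module.End k (ℕ → ℕ → V) where
  toFun f m n := f m (n + 1) - ((m : k) * 2⁻¹) • f (m + 1) n
  map_add' f g := by ext; simp; abel
  map_smul' c f := by ext; simp; module

/-- The operator dual to left multiplication by `x₃`, given its action on the fibre. -/
def T3 (q : k) (D E : Module.End k V) : Module.End k (ℕ → ℕ → V) where
  toFun f m n := q⁻¹ ^ (m + n) • (D (f m n) - (n : k) • E (f m (n - 1)))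
  map_add' f g := by ext; simp; module
  map_smul' c f := by ext; simp; module

variable {q ω : k} {D E W : Module.End k V}

theorem T1_apply (f : ℕ → ℕ → V) (m n : ℕ) : T1 k V f m n = f (m + 1) n := rfl

theorem T2_apply (f : ℕ → ℕ → V) (m n : ℕ) :
    T2 k V f m n = f m (n + 1) - ((m : k) * 2⁻¹) • f (m + 1) n := rfl

theorem T3_apply (f : ℕ → ℕ → V) (m n : ℕ) :
    T3 q D E f m n = q⁻¹ ^ (m + n) • (D (f m n) - (n : k) • E (f m (n - 1))) := rfl

theorem T1_mul_T2 : T1 k V * T2 k V - T2 k V * T1 k V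
    + (2 : k)⁻¹ • (T1 k V * T1 k V) = 0 := by
  refine LinearMap.ext fun f => funext fun m => funext fun n => ?_
  simp [T1_apply, T2_apply]
  module

theorem T3_mul_T1 (hq : q ≠ 0) : T3 q D E * T1 k V - q • (T1 k V * T3 q D E) = 0 := by
  refine LinearMap.ext fun f => funext fun m => funext fun n => ?_
  simp [T1_apply, T3_apply]
  match_scalars <;> simp <;> grind

/-- The operator dual to left multiplication by `z₁`. -/
def TZ1 (q : k) (D E : Module.End k V) : Module.End k (ℕ → ℕ → V) :=
  T3 q D E * T2 k V - q • (T2 k V * T3 q D E)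

theorem TZ1_apply (hq : q ≠ 0) (f : ℕ → ℕ → V) (m n : ℕ) :
    TZ1 q D E f m n = q⁻¹ ^ (m + n) • E (f m n) := by
  rcases n with _ | n
  all_goals
    simp [TZ1, T2_apply, T3_apply]
    match_scalars <;> grind

theorem TZ1_mul_T2 (hq : q ≠ 0) : TZ1 q D E * T2 k V - q • (T2 k V * TZ1 q D E) = 0 := by
  refine LinearMap.ext fun f => funext fun m => funext fun n => ?_
  simp [T2_apply, TZ1_apply hq]
  match_scalars <;> grind

theorem TZ1_cube (hq : q ≠ 0) (hE : ∀ g, E (E (E g)) = 0) : TZ1 q D E ^ 3 = 0 := by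
  refine LinearMap.ext fun f => funext fun m => funext fun n => ?_
  simp [pow_three, TZ1_apply hq, hE]

theorem T3_cube (hq : q ≠ 0) (hD : ∀ g, D (D (D g)) = 0) (hE : ∀ g, E (E (E g)) = 0)
    (h₁ : ∀ g, D (D (E g)) + q • D (E (D g)) + q ^ 2 • E (D (D g)) = 0)
    (h₂ : ∀ g, D (E (E g)) + q • E (D (E g)) + q ^ 2 • E (E (D g)) = 0) :
    T3 q D E ^ 3 = 0 := by
  have h₁' : ∀ g, D (D (E g)) = - q • D (E (D g)) - q ^ 2 • E (D (D g)) := fun g => by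
    linear_combination (norm := module) h₁ g
  have h₂' : ∀ g, D (E (E g)) = - q • E (D (E g)) - q ^ 2 • E (E (D g)) := fun g => by
    linear_combination (norm := module) h₂ g
  refine LinearMap.ext fun f => funext fun m => funext fun n => ?_
  rcases n with _ | _ | _ | n
  all_goals
    simp only [pow_three, T3_apply, hD, hE, h₁', h₂', Module.End.mul_apply, map_sub, map_smul, map_zero,
      LinearMap.zero_apply, Pi.zero_apply, smul_zero, zero_smul, Nat.cast_zero,
      Nat.add_sub_cancel, neg_smul, smul_sub, smul_neg, Nat.cast_add, Nat.cast_one]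
    match_scalars <;> field_simp <;> grind

/-- The operator dual to left multiplication by `z₁₀`. -/
def TZ10 (q ω : k) (D E : Module.End k V) : Module.End k (ℕ → ℕ → V) :=
  T3 q D E * TZ1 q D E - (q * ω) • (TZ1 q D E * T3 q D E)

theorem TZ10_apply (hq : q ≠ 0) (hW : ∀ g, W g = D (E g) - (q * ω) • E (D g))
    (f : ℕ → ℕ → V) (m n : ℕ) :
    TZ10 q ω D E f m n = q⁻¹ ^ (2 * (m + n)) •
      (W (f m n) - (q * (1 - ω) * (n : k)) • E (E (f m (n - 1)))) := by
  rcases n with _ | n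
  all_goals
    simp [TZ10, TZ1_apply hq, T3_apply, hW]
    match_scalars <;> field_simp <;> ring

theorem TZ10_cube (hq : q ≠ 0) (hω : ω ^ 2 + ω + 1 = 0)
    (hW : ∀ g, W g = D (E g) - (q * ω) • E (D g))
    (hWE : ∀ g, W (E g) = (q * ω ^ 2) • E (W g)) (hW3 : ∀ g, W (W (W g)) = 0)
    (hE : ∀ g, E (E (E g)) = 0) : TZ10 q ω D E ^ 3 = 0 := by
  refine LinearMap.ext fun f => funext fun m => funext fun n => ?_
  rcases n with _ | _ | _ | n
  all_goals
    simp only [pow_three, TZ10_apply hq hW, hWE, hE, hW3, Module.End.mul_apply, map_sub, map_smul, map_zero,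
      LinearMap.zero_apply, Pi.zero_apply, smul_zero, Nat.cast_zero,
      Nat.add_sub_cancel, smul_sub, Nat.cast_add, Nat.cast_one]
    match_scalars
    field_simp
    grind

end Total

end LstrAction

section GKdim

theorem tendsto_ofReal_log_add_div_log (a : ℝ) (d : ℕ) :
    Filter.Tendsto (fun n : ℕ => ENNReal.ofReal ((a + d * Real.log n) / Real.log n)) Filter.atTop
      (nhds (d : ℝ≥0∞)) := by
  rw [← ENNReal.ofReal_natCast]
  refine (ENNReal.continuous_ofReal.tendsto _).comp ?_
  have hlog : Filter.Tendsto (fun n : ℕ => Real.log n) Filter.atTop Filter.atTop :=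
    Real.tendsto_log_atTop.comp tendsto_natCast_atTop_atTop
  have h : Filter.Tendsto (fun n : ℕ => a / Real.log n + d) Filter.atTop (nhds (0 + (d : ℝ))) :=
    (hlog.const_div_atTop a).add tendsto_const_nhds
  rw [zero_add] at h
  refine h.congr' ?_
  filter_upwards [hlog.eventually_gt_atTop 0] with n hn
  field_simp

variable {k A : Type*} [Field k] [Ring A] [Algebra k A]

theorem GKdim_le_of_forall_finrank_le (d : ℕ)
    (h : ∀ V : Submodule k A, FiniteDimensional k V → ∃ C : ℕ, ∀ n : ℕ, 1 ≤ n →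
      Module.finrank k (↥(∑ j ∈ Finset.range (n + 1), V ^ j)) ≤ C * n ^ d) :
    GKdim k A ≤ d := by
  refine iSup₂_le fun V hV => ?_
  obtain ⟨C, hC⟩ := h V hV
  rw [← (tendsto_ofReal_log_add_div_log (Real.log ((C + 1 : ℕ) : ℝ)) d).limsup_eq]
  refine Filter.limsup_le_limsup ?_
  filter_upwards [Filter.eventually_ge_atTop 1] with n hn
  refine ENNReal.ofReal_le_ofReal (div_le_div_of_nonneg_right ?_ (Real.log_natCast_nonneg n))
  have hn' : (n : ℝ) ≠ 0 := by positivity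
  rw [← Real.log_pow, ← Real.log_mul (by positivity) (by positivity)]
  set r := Module.finrank k (↥(∑ j ∈ Finset.range (n + 1), V ^ j))
  have hr : r ≤ (C + 1) * n ^ d := (hC n hn).trans (Nat.mul_le_mul_right _ (Nat.le_succ C))
  rcases Nat.eq_zero_or_pos r with h0 | h0
  · rw [h0, Nat.cast_zero, Real.log_zero]
    exact_mod_cast Real.log_natCast_nonneg ((C + 1) * n ^ d)
  · exact Real.log_le_log (by exact_mod_cast h0) (by exact_mod_cast hr)

theorem le_GKdim_of_forall_le_finrank (d C : ℕ) (hC : 0 < C) (V : Submodule k A)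
    [hV : FiniteDimensional k V]
    (h : ∀ n : ℕ, n ^ d ≤ C * Module.finrank k (↥(∑ j ∈ Finset.range (n + 1), V ^ j))) :
    d ≤ GKdim k A := by
  refine le_trans ?_ (le_iSup₂ (f := fun (V : Submodule k A) (_ : FiniteDimensional k V) =>
    Filter.limsup (fun n : ℕ => ENNReal.ofReal
      (Real.log ((Module.finrank k (↥(∑ j ∈ Finset.range (n + 1), V ^ j)) : ℕ) : ℝ) /
        Real.log (n : ℝ))) Filter.atTop) V hV)
  rw [← (tendsto_ofReal_log_add_div_log (-Real.log (C : ℝ)) d).limsup_eq]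
  refine Filter.limsup_le_limsup ?_
  filter_upwards [Filter.eventually_ge_atTop 1] with n hn
  refine ENNReal.ofReal_le_ofReal (div_le_div_of_nonneg_right ?_ (Real.log_natCast_nonneg n))
  have hn' : (0 : ℝ) < (n : ℝ) ^ d := by positivity
  have hr := h n
  set r := Module.finrank k (↥(∑ j ∈ Finset.range (n + 1), V ^ j))
  have h0 : 0 < r := by
    refine Nat.pos_of_ne_zero fun h0 => ?_
    rw [h0, mul_zero] at hr
    exact (pow_pos hn d).not_ge hr
  rw [← Real.log_pow, neg_add_le_iff_le_add, ← Real.log_mul (by positivity) (by positivity)]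
  exact Real.log_le_log hn' (by exact_mod_cast hr)

end GKdim

namespace LstrAction

variable {k : Type*} [Field k]

/-- The dual of the fibre: functions of the exponents of `z₁`, `z₁₀` and `z₀`. -/
abbrev Fiber (k : Type*) : Type _ := Fin 3 → Fin 3 → Fin 3 → k

/-- The action of `z₀` on the dual of the fibre. -/
def fiberZ0 (q ω : k) : Module.End k (Fiber k) :=
  Z0 q ω (shift k (Fin 3 → k)) (innerShift (q⁻¹ * ω))

/-- The action of `z₁` on the dual of the fibre. -/
def fiberZ1 (k : Type*) [Field k] : Module.End k (Fiber k) := shift k (Fin 3 → Fin 3 → k)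

/-- The action of `z₁₀` on the dual of the fibre. -/
def fiberZ10 (q ω : k) : Module.End k (Fiber k) :=
  Z10 q ω (shift k (Fin 3 → k)) (innerShift (q⁻¹ * ω))

/-- The operators through which the generators act on functions of the exponents. -/
def generator (q ω : k) : Fin 3 → Module.End k (ℕ → ℕ → Fiber k) :=
  ![T1 k (Fiber k), T2 k (Fiber k), T3 q (fiberZ0 q ω) (fiberZ1 k)]

/-- The right action of the free algebra on functions of the exponents. -/
noncomputable def freeAction (q ω : k) :
    FreeAlgebra k (Fin 3) →ₐ[k] (Module.End k (ℕ → ℕ → Fiber k))ᵐᵒᵖ :=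
  FreeAlgebra.lift k fun i => MulOpposite.op (generator q ω i)

theorem freeAction_X_zero (q ω : k) :
    freeAction q ω (X k 0) = MulOpposite.op (T1 k (Fiber k)) := by
  simp [freeAction, X, generator]

theorem freeAction_X_one (q ω : k) :
    freeAction q ω (X k 1) = MulOpposite.op (T2 k (Fiber k)) := by
  simp [freeAction, X, generator]

theorem freeAction_X_two (q ω : k) :
    freeAction q ω (X k 2) = MulOpposite.op (T3 q (fiberZ0 q ω) (fiberZ1 k)) := by
  simp [freeAction, X, generator]

theorem freeAction_z1 (q ω : k) :
    freeAction q ω (z1 k q) = MulOpposite.op (TZ1 q (fiberZ0 q ω) (fiberZ1 k)) := by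
  rw [z1, map_sub, map_smul, map_mul, map_mul, freeAction_X_one, freeAction_X_two, TZ1]
  rfl

theorem freeAction_z10 (q ω : k) :
    freeAction q ω (z10 k q ω) = MulOpposite.op (TZ10 q ω (fiberZ0 q ω) (fiberZ1 k)) := by
  rw [z10, map_sub, map_smul, map_mul, map_mul, freeAction_z1, freeAction_X_two, TZ10]
  rfl

theorem freeAction_eq_of_lstrRel {q ω : k} (hq : q ≠ 0) (hω : ω ^ 2 + ω + 1 = 0)
    {a b : FreeAlgebra k (Fin 3)} (hab : lstrRel k q ω a b) :
    freeAction q ω a = freeAction q ω b := by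
  have hBC := shift_innerShift (k := k) (q⁻¹ * ω)
  have hB := shift_shift_shift (k := k) (V := Fin 3 → k)
  have hC := innerShift_cube (k := k) (q⁻¹ * ω)
  have hE := shift_shift_shift (k := k) (V := Fin 3 → Fin 3 → k)
  obtain ⟨rfl, rfl | rfl | rfl | rfl | rfl | rfl⟩ := hab
  all_goals rw [map_zero]
  · rw [map_add, map_sub, map_smul, map_mul, map_mul, map_mul, freeAction_X_zero,
      freeAction_X_one]
    exact congrArg MulOpposite.op T1_mul_T2
  · rw [map_sub, map_smul, map_mul, map_mul, freeAction_X_zero, freeAction_X_two]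
    exact congrArg MulOpposite.op (T3_mul_T1 hq)
  · rw [z2, map_sub, map_smul, map_mul, map_mul, freeAction_z1, freeAction_X_one]
    exact congrArg MulOpposite.op (TZ1_mul_T2 hq)
  · rw [map_pow, freeAction_X_two]
    exact congrArg MulOpposite.op (T3_cube hq (Z0_cube hω hBC hC) hE (serre_one hq hω hBC)
      (serre_two hq hω))
  · rw [map_pow, freeAction_z1]
    exact congrArg MulOpposite.op (TZ1_cube hq hE)
  · rw [map_pow, freeAction_z10]
    exact congrArg MulOpposite.op (TZ10_cube (W := fiberZ10 q ω) hq hω Z10_apply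
      (Z10_shift hq hω) (Z10_cube hq hω hB) hE)

/-- The right action of `B(lstr(ω,1))` on functions of the exponents. -/
noncomputable def action {q ω : k} (hq : q ≠ 0) (hω : ω ^ 2 + ω + 1 = 0) :
    RingQuot (lstrRel k q ω) →ₐ[k] (Module.End k (ℕ → ℕ → Fiber k))ᵐᵒᵖ :=
  RingQuot.liftAlgHom k ⟨freeAction q ω, fun _ _ h => freeAction_eq_of_lstrRel hq hω h⟩

theorem pow_apply_of_semiconj {M N : Type*} [AddCommGroup M] [Module k M] [AddCommGroup N]
    [Module k N] {S : Module.End k M} {T : Module.End k N} (ρ : M → N)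
    (h : ∀ f, ρ (S f) = T (ρ f)) (n : ℕ) (f : M) : ρ ((S ^ n) f) = (T ^ n) (ρ f) := by
  rw [Module.End.pow_apply, Module.End.pow_apply]
  exact Function.Semiconj.iterate_right h n f

theorem shift_pow_apply_zero {V : Type*} [AddCommGroup V] [Module k V] (g : Fin 3 → V)
    (a : Fin 3) : (shift k V ^ (a : ℕ)) g 0 = g a := by
  fin_cases a <;> simp [shift_apply, pow_succ]

theorem T1_pow_apply {V : Type*} [AddCommGroup V] [Module k V] (f : ℕ → ℕ → V) (i m n : ℕ) :
    (T1 k V ^ i) f m n = f (m + i) n := by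
  induction i generalizing f with
  | zero => simp
  | succ i ih => rw [pow_succ, Module.End.mul_apply, ih, T1_apply]; rfl

theorem T2_pow_apply_zero {V : Type*} [AddCommGroup V] [Module k V] (f : ℕ → ℕ → V) (j n : ℕ) :
    (T2 k V ^ j) f 0 n = f 0 (n + j) := by
  induction j generalizing f with
  | zero => simp
  | succ j ih => rw [pow_succ, Module.End.mul_apply, ih, T2_apply]; simp; rfl

theorem action_bas {q ω : k} (hq : q ≠ 0) (hω : ω ^ 2 + ω + 1 = 0)
    (p : ℕ × ℕ × Fin 3 × Fin 3 × Fin 3) (f : ℕ → ℕ → Fiber k) :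
    (action hq hω (bas k q ω p)).unop f 0 0 0 0 0
      = f p.1 p.2.1 p.2.2.1 p.2.2.2.1 p.2.2.2.2 := by
  obtain ⟨i, j, a, b, c⟩ := p
  have h3 := pow_apply_of_semiconj (S := T3 q (fiberZ0 q ω) (fiberZ1 k)) (T := fiberZ0 q ω)
    (fun f => f 0 0) (fun f => by simp [T3_apply]) c
  have hz1 := pow_apply_of_semiconj (S := TZ1 q (fiberZ0 q ω) (fiberZ1 k)) (T := fiberZ1 k)
    (fun f => f 0 0) (fun f => by simp [TZ1_apply hq]) a
  have hz10 := pow_apply_of_semiconj (S := TZ10 q ω (fiberZ0 q ω) (fiberZ1 k))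
    (T := fiberZ10 q ω) (fun f => f 0 0)
    (fun f => by
      simp [TZ10_apply (D := fiberZ0 q ω) (E := fiberZ1 k) (W := fiberZ10 q ω) hq Z10_apply]) b
  have hC := pow_apply_of_semiconj (S := fiberZ0 q ω) (T := shift k k) (fun g => g 0 0)
    (fun g => by simp [fiberZ0, Z0_apply, innerShift_apply]) c
  have hB := pow_apply_of_semiconj (S := fiberZ10 q ω) (T := shift k (Fin 3 → k)) (fun g => g 0)
    (fun g => by rw [fiberZ10, Z10_apply' hq hω]; rfl) b
  simp only [action, bas, RingQuot.liftAlgHom_mkAlgHom_apply, map_mul, map_pow,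
    freeAction_X_zero, freeAction_X_one, freeAction_X_two, freeAction_z1, freeAction_z10,
    MulOpposite.unop_mul, MulOpposite.unop_pow, MulOpposite.unop_op, Module.End.mul_apply]
  rw [h3, hC, hz10, hB, hz1, fiberZ1, shift_pow_apply_zero, shift_pow_apply_zero,
    shift_pow_apply_zero, T2_pow_apply_zero, T1_pow_apply, zero_add, zero_add]

theorem linearIndependent_bas {q ω : k} (hq : q ≠ 0) (hω : ω ^ 2 + ω + 1 = 0) :
    LinearIndependent k (bas k q ω) := by
  classical
  rw [linearIndependent_iff']
  intro s g hg p hp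
  let f : ℕ → ℕ → Fiber k := fun i j a b c => if (i, j, a, b, c) = p then 1 else 0
  have h := congrArg (fun w => (action hq hω w).unop f 0 0 0 0 0) hg
  simpa [map_sum, map_smul, Finset.sum_apply, LinearMap.sum_apply, action_bas, f, hp] using h

end LstrAction

theorem lstrTuple_mk {k : Type*} [Field k] (q ω : k) :
    LstrTuple q ω (RingQuot.mkAlgHom k (lstrRel k q ω) (X k 0))
      (RingQuot.mkAlgHom k (lstrRel k q ω) (X k 1)) (RingQuot.mkAlgHom k (lstrRel k q ω) (X k 2))
      (RingQuot.mkAlgHom k (lstrRel k q ω) (z1 k q))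
      (RingQuot.mkAlgHom k (lstrRel k q ω) (z10 k q ω)) := by
  have key : ∀ a, lstrRel k q ω a 0 → RingQuot.mkAlgHom k (lstrRel k q ω) a = 0 := fun a h => by
    rw [RingQuot.mkAlgHom_rel k h, map_zero]
  constructor
  · have h := key _ ⟨rfl, Or.inl rfl⟩
    rw [map_add, map_sub, map_smul, map_mul, map_mul, map_mul] at h
    linear_combination (norm := module) h
  · have h := key _ ⟨rfl, Or.inr (Or.inl rfl)⟩
    rwa [map_sub, map_smul, map_mul, map_mul, sub_eq_zero] at h
  · rw [z1, map_sub, map_smul, map_mul, map_mul]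
    module
  · have h := key _ ⟨rfl, Or.inr (Or.inr (Or.inl rfl))⟩
    rwa [z2, map_sub, map_smul, map_mul, map_mul, sub_eq_zero] at h
  · rw [z10, map_sub, map_smul, map_mul, map_mul]
  · have h := key _ ⟨rfl, Or.inr (Or.inr (Or.inr (Or.inl rfl)))⟩
    rwa [map_pow] at h
  · have h := key _ ⟨rfl, Or.inr (Or.inr (Or.inr (Or.inr (Or.inl rfl))))⟩
    rwa [map_pow] at h
  · have h := key _ ⟨rfl, Or.inr (Or.inr (Or.inr (Or.inr (Or.inr rfl))))⟩
    rwa [map_pow] at h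

section Filtration

variable {k : Type*} [Field k]

/-- The elements of degree at most `N` in `x₁, x₂`. -/
noncomputable def lstrFiltration (q ω : k) (N : ℕ) : Submodule k (RingQuot (lstrRel k q ω)) :=
  LstrTuple.monomialSpan k (RingQuot.mkAlgHom k (lstrRel k q ω) (X k 0))
    (RingQuot.mkAlgHom k (lstrRel k q ω) (X k 1)) (RingQuot.mkAlgHom k (lstrRel k q ω) (X k 2))
    (RingQuot.mkAlgHom k (lstrRel k q ω) (z1 k q))
    (RingQuot.mkAlgHom k (lstrRel k q ω) (z10 k q ω)) N

theorem lstrFiltration_eq_span_bas (q ω : k) (N : ℕ) :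
    lstrFiltration q ω N = Submodule.span k (bas k q ω '' {p | p.1 + p.2.1 ≤ N}) := by
  rw [lstrFiltration, (lstrTuple_mk q ω).monomialSpan_eq_span_truncated]
  congr 2
  ext p
  simp only [bas, map_mul, map_pow]

theorem setOf_add_le_subset_product (N : ℕ) :
    {p : ℕ × ℕ × Fin 3 × Fin 3 × Fin 3 | p.1 + p.2.1 ≤ N} ⊆
      ((Finset.range (N + 1) ×ˢ Finset.range (N + 1) ×ˢ Finset.univ :
        Finset (ℕ × ℕ × Fin 3 × Fin 3 × Fin 3)) : Set _) := by
  intro p hp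
  simp only [Set.mem_ofPred_eq] at hp
  simp
  omega

theorem lstrFiltration_le_span (q ω : k) (N : ℕ) : lstrFiltration q ω N ≤
    Submodule.span k (((Finset.range (N + 1) ×ˢ Finset.range (N + 1) ×ˢ Finset.univ :
        Finset (ℕ × ℕ × Fin 3 × Fin 3 × Fin 3)) : Set _).image (bas k q ω)) := by
  rw [lstrFiltration_eq_span_bas]
  exact Submodule.span_mono (Set.image_mono (setOf_add_le_subset_product N))

instance (q ω : k) (N : ℕ) : FiniteDimensional k (lstrFiltration q ω N) := by
  have := FiniteDimensional.span_of_finite k ((Finset.finite_toSet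
    (Finset.range (N + 1) ×ˢ Finset.range (N + 1) ×ˢ (Finset.univ :
      Finset (Fin 3 × Fin 3 × Fin 3)))).image (bas k q ω))
  exact Submodule.finiteDimensional_of_le (lstrFiltration_le_span q ω N)

theorem finrank_lstrFiltration_le (q ω : k) (N : ℕ) :
    Module.finrank k (lstrFiltration q ω N) ≤ 27 * (N + 1) ^ 2 := by
  classical
  have h := lstrFiltration_le_span q ω N
  rw [← Finset.coe_image] at h
  refine (Submodule.finrank_mono h).trans ((finrank_span_finset_le_card _).trans
    (Finset.card_image_le.trans (le_of_eq ?_)))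
  simp
  ring

theorem lstrFiltration_mono (q ω : k) : Monotone (lstrFiltration q ω) :=
  fun _ _ h => LstrTuple.monomialSpan_mono h

theorem exists_mem_lstrFiltration [CharZero k] {q ω : k} (hq : q ≠ 0) (hω : ω ^ 2 + ω + 1 = 0)
    (w : RingQuot (lstrRel k q ω)) : ∃ N, w ∈ lstrFiltration q ω N := by
  have ht := lstrTuple_mk q ω
  obtain ⟨w, rfl⟩ := RingQuot.mkAlgHom_surjective k (lstrRel k q ω) w
  induction w using FreeAlgebra.induction with
  | grade0 r =>
    refine ⟨0, ?_⟩
    rw [AlgHom.commutes, Algebra.algebraMap_eq_smul_one]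
    exact Submodule.smul_mem _ r (LstrTuple.one_mem_monomialSpan 0)
  | grade1 i =>
    have h1 := LstrTuple.one_mem_monomialSpan (k := k)
      (x := RingQuot.mkAlgHom k (lstrRel k q ω) (X k 0))
      (y := RingQuot.mkAlgHom k (lstrRel k q ω) (X k 1))
      (z := RingQuot.mkAlgHom k (lstrRel k q ω) (X k 2))
      (u := RingQuot.mkAlgHom k (lstrRel k q ω) (z1 k q))
      (v := RingQuot.mkAlgHom k (lstrRel k q ω) (z10 k q ω)) 0
    fin_cases i
    · exact ⟨1, (mul_one (RingQuot.mkAlgHom k (lstrRel k q ω) _)) ▸ LstrTuple.x_mul_mem h1⟩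
    · exact ⟨1, (mul_one (RingQuot.mkAlgHom k (lstrRel k q ω) _)) ▸ ht.y_mul_mem h1⟩
    · exact ⟨0, (mul_one (RingQuot.mkAlgHom k (lstrRel k q ω) _)) ▸ ht.z_mul_mem hq hω h1⟩
  | mul a b ha hb =>
    obtain ⟨M, hM⟩ := ha
    obtain ⟨N, hN⟩ := hb
    exact ⟨M + N, by rw [map_mul]; exact ht.mul_mem_monomialSpan hq hω hM hN⟩
  | add a b ha hb =>
    obtain ⟨M, hM⟩ := ha
    obtain ⟨N, hN⟩ := hb
    refine ⟨max M N, ?_⟩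
    rw [map_add]
    exact add_mem (lstrFiltration_mono q ω (le_max_left M N) hM)
      (lstrFiltration_mono q ω (le_max_right M N) hN)

theorem exists_le_lstrFiltration [CharZero k] {q ω : k} (hq : q ≠ 0) (hω : ω ^ 2 + ω + 1 = 0)
    (V : Submodule k (RingQuot (lstrRel k q ω))) [FiniteDimensional k V] :
    ∃ N, V ≤ lstrFiltration q ω N := by
  obtain ⟨s, rfl⟩ := (Submodule.fg_iff_finiteDimensional V).mpr inferInstance
  choose N hN using exists_mem_lstrFiltration (k := k) hq hω
  exact ⟨s.sup N, Submodule.span_le.mpr fun w hw =>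
    lstrFiltration_mono q ω (Finset.le_sup hw) (hN w)⟩

theorem GKdim_lstr_le [CharZero k] {q ω : k} (hq : q ≠ 0) (hω : ω ^ 2 + ω + 1 = 0) :
    GKdim k (RingQuot (lstrRel k q ω)) ≤ 2 := by
  refine GKdim_le_of_forall_finrank_le 2 fun V hV => ?_
  obtain ⟨d, hd⟩ := exists_le_lstrFiltration hq hω V
  refine ⟨27 * (d + 1) ^ 2, fun n hn => ?_⟩
  have hle : ∑ j ∈ Finset.range (n + 1), V ^ j ≤ lstrFiltration q ω (n * d) := by
    refine Finset.sum_induction _ (· ≤ lstrFiltration q ω (n * d)) (fun _ _ => sup_le) bot_le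
      fun j hj => ((lstrTuple_mk q ω).pow_le_monomialSpan hq hω hd j).trans
        (lstrFiltration_mono q ω (Nat.mul_le_mul_right d ?_))
    exact Nat.lt_succ_iff.mp (Finset.mem_range.mp hj)
  calc _ ≤ _ := Submodule.finrank_mono hle
    _ ≤ _ := finrank_lstrFiltration_le q ω (n * d)
    _ ≤ 27 * (n * d + n) ^ 2 := by gcongr
    _ = _ := by ring

theorem le_GKdim_lstr {q ω : k} (hq : q ≠ 0) (hω : ω ^ 2 + ω + 1 = 0) :
    2 ≤ GKdim k (RingQuot (lstrRel k q ω)) := by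
  let x := RingQuot.mkAlgHom k (lstrRel k q ω) (X k 0)
  let y := RingQuot.mkAlgHom k (lstrRel k q ω) (X k 1)
  let V : Submodule k (RingQuot (lstrRel k q ω)) := Submodule.span k {x, y}
  have hV : FiniteDimensional k V := FiniteDimensional.span_of_finite k (by simp)
  refine le_GKdim_of_forall_le_finrank 2 4 (by norm_num) V fun n => ?_
  let S : Submodule k (RingQuot (lstrRel k q ω)) := ∑ j ∈ Finset.range (n + 1), V ^ j
  have hS : FiniteDimensional k S := by
    rw [← Submodule.fg_iff_finiteDimensional]
    refine Finset.sum_induction _ Submodule.FG (fun _ _ => Submodule.FG.sup) Submodule.fg_bot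
      fun j _ => Submodule.FG.pow ((Submodule.fg_iff_finiteDimensional V).mpr hV) j
  have hmem : ∀ i j : Fin (n / 2 + 1), bas k q ω (i, j, 0, 0, 0) ∈ S := by
    intro i j
    have hij : (i : ℕ) + j ∈ Finset.range (n + 1) := Finset.mem_range.mpr (by omega)
    refine (Finset.single_le_sum (f := fun j => V ^ j) (fun _ _ => bot_le) hij :
      V ^ ((i : ℕ) + j) ≤ S) ?_
    have hx : x ∈ V := Submodule.subset_span (by simp)
    have hy : y ∈ V := Submodule.subset_span (by simp)
    have := Submodule.mul_mem_mul (Submodule.pow_mem_pow V hx i) (Submodule.pow_mem_pow V hy j)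
    rw [pow_add]
    simpa [bas] using this
  let e : Fin (n / 2 + 1) × Fin (n / 2 + 1) → S := fun p => ⟨_, hmem p.1 p.2⟩
  have he : LinearIndependent k e := by
    refine LinearIndependent.of_comp S.subtype ?_
    refine (LstrAction.linearIndependent_bas hq hω).comp
      (fun p : Fin (n / 2 + 1) × Fin (n / 2 + 1) =>
        ((p.1 : ℕ), (p.2 : ℕ), (0 : Fin 3), (0 : Fin 3), (0 : Fin 3))) ?_
    intro p p' h
    simp only [Prod.mk.injEq, Fin.val_inj, and_true] at h
    exact Prod.ext h.1 h.2
  have hcard := he.fintype_card_le_finrank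
  simp only [Fintype.card_prod, Fintype.card_fin] at hcard
  have hn : n ≤ 2 * (n / 2 + 1) := by omega
  calc n ^ 2 ≤ (2 * (n / 2 + 1)) ^ 2 := Nat.pow_le_pow_left hn 2
    _ = 4 * ((n / 2 + 1) * (n / 2 + 1)) := by ring
    _ ≤ _ := Nat.mul_le_mul_left 4 hcard

end Filtration

/-- The PBW monomials form a basis of `B(lstr(ω,1))`, and
`GKdim B(lstr(ω,1)) = 2`. -/
theorem statement13 (k : Type*) [Field k] [IsAlgClosed k] [CharZero k]
    (q : k) (hq : q ≠ 0) (ω : k) (hω : IsPrimitiveRoot ω 3) :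
    (LinearIndependent k (bas k q ω) ∧
      Submodule.span k (Set.range (bas k q ω)) = ⊤) ∧
    GKdim k (RingQuot (lstrRel k q ω)) = 2 := by
  have hω' : ω ^ 2 + ω + 1 = 0 := by
    have h := hω.geom_sum_eq_zero (by norm_num)
    simp only [Finset.sum_range_succ, Finset.sum_range_zero, pow_zero, pow_one] at h
    linear_combination h
  refine ⟨⟨LstrAction.linearIndependent_bas hq hω', ?_⟩,
    le_antisymm (GKdim_lstr_le hq hω') (le_GKdim_lstr hq hω')⟩
  refine eq_top_iff.mpr fun w _ => ?_
  obtain ⟨N, hN⟩ := exists_mem_lstrFiltration hq hω' w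
  rw [lstrFiltration_eq_span_bas] at hN
  exact Submodule.span_mono (Set.image_subset_range _ _) hN
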